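/- Let X be a connected, indecomposable Tychonoff space. Then every irreducible Hausdorff compactification of X is indecomposable; equivalently, every decomposable compactification γX of X (one expressible as the union of two proper subcontinua) is reducible between every pair of its points. -/

import Mathlib

/-- A space is *strongly indecomposable* if for every two nonempty disjoint open
sets `U` and `V` there are closed sets `A`, `B` covering the space, each meeting `U`,
with `A ∩ B ⊆ V`. -/
def StronglyIndecomposable (X : Type*) [TopologicalSpace X] : Prop :=
  ∀ U V : Set X, IsOpen U → IsOpen V → U.Nonempty → V.Nonempty → Disjoint U V →
    ∃ A B : Set X, IsClosed A ∧ IsClosed B ∧ A ∪ B = Set.univ ∧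
      (A ∩ U).Nonempty ∧ (B ∩ U).Nonempty ∧ A ∩ B ⊆ V

/-- A space is *indecomposable* if every connected subset is dense or nowhere dense. -/
def IndecomposableSpace (X : Type*) [TopologicalSpace X] : Prop :=
  ∀ C : Set X, IsConnected C → Dense C ∨ IsNowhereDense C

/-- If `A` and `B` are disjoint open sets partitioning the trace on a dense connected subspace of
the complement of a continuum `K`, then `closure A ∪ K` is connected. -/
theorem isPreconnected_closure_image_union {X γ : Type*} [TopologicalSpace X]
    [PreconnectedSpace X] [TopologicalSpace γ] {e : X → γ}
    (he : Topology.IsEmbedding e) (hd : DenseRange e) {K : Set γ} (hK : IsClosed K)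
    (hKc : IsPreconnected K) {A B : Set X} (hA : IsOpen A) (hB : IsOpen B)
    (hAB : Disjoint A B) (hu : A ∪ B = e ⁻¹' Kᶜ) :
    IsPreconnected (closure (e '' A) ∪ K) := by
  have hs : IsClosed (closure (e '' A) ∪ K) := isClosed_closure.union hK
  have key : ∀ u v : Set γ, IsClosed u → IsClosed v → closure (e '' A) ∪ K ⊆ u ∪ v →
      Disjoint u v → K ⊆ u → closure (e '' A) ∪ K ⊆ u ∨ closure (e '' A) ∪ K ⊆ v := by
    intro u v hu' hv' hsub hdis hKu
    have hmem : ∀ x ∈ A, e x ∈ u ∪ v := fun x hx =>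
      hsub (Or.inl (subset_closure (Set.mem_image_of_mem e hx)))
    have hopen : A ∩ e ⁻¹' v = A ∩ e ⁻¹' uᶜ := by
      ext x
      constructor
      · rintro ⟨hx, hxv⟩
        exact ⟨hx, fun hxu => hdis.le_bot ⟨hxu, hxv⟩⟩
      · rintro ⟨hx, hxu⟩
        exact ⟨hx, (hmem x hx).resolve_left hxu⟩
    have hclosed : A ∩ e ⁻¹' v = closure A ∩ e ⁻¹' v := by
      ext x
      constructor
      · rintro ⟨hx, hxv⟩
        exact ⟨subset_closure hx, hxv⟩
      · rintro ⟨hx, hxv⟩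
        have hxK : x ∈ A ∪ B := by
          rw [hu]
          exact fun hxK => hdis.le_bot ⟨hKu hxK, hxv⟩
        exact ⟨hxK.resolve_right fun hxB =>
          (hAB.closure_left hB).le_bot ⟨hx, hxB⟩, hxv⟩
    have hclopen : IsClopen (A ∩ e ⁻¹' v) := by
      constructor
      · rw [hclosed]
        exact isClosed_closure.inter (hv'.preimage he.continuous)
      · rw [hopen]
        exact hA.inter (hu'.isOpen_compl.preimage he.continuous)
    rcases isClopen_iff.1 hclopen with h | h
    · left
      refine Set.union_subset (closure_minimal ?_ hu') hKu
      rintro _ ⟨x, hx, rfl⟩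
      refine (hmem x hx).resolve_right fun hxv => ?_
      have hx' : x ∈ A ∩ e ⁻¹' v := ⟨hx, hxv⟩
      rw [h] at hx'
      exact hx'
    · right
      have hr : closure (Set.range e) ⊆ v := by
        refine closure_minimal ?_ hv'
        rintro _ ⟨x, rfl⟩
        have hx : x ∈ A ∩ e ⁻¹' v := h ▸ Set.mem_univ x
        exact hx.2
      rw [hd.closure_range] at hr
      exact (Set.subset_univ _).trans hr
  rw [isPreconnected_iff_subset_of_fully_disjoint_closed hs]
  intro u v hu' hv' hsub hdis
  rcases (isPreconnected_iff_subset_of_fully_disjoint_closed hK).1 hKc u v hu' hv'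
    (Set.subset_union_right.trans hsub) hdis with h | h
  · exact key u v hu' hv' hsub hdis h
  · exact (key v u hv' hu' (Set.union_comm u v ▸ hsub) hdis.symm h).symm

/-- If no proper subcontinuum contains both `p ∉ K` and `q ∈ K`, where `K` is a continuum, then the
trace of the complement of `K` on a dense connected subspace is connected. -/
theorem isPreconnected_preimage_compl_of_irreducible {X γ : Type*} [TopologicalSpace X]
    [PreconnectedSpace X] [TopologicalSpace γ] {e : X → γ}
    (he : Topology.IsEmbedding e) (hd : DenseRange e) {K : Set γ} (hK : IsClosed K)
    (hKc : IsPreconnected K) {p q : γ} (hp : p ∉ K) (hq : q ∈ K)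
    (hirr : ∀ C : Set γ, IsClosed C → IsPreconnected C → p ∈ C → q ∈ C → C = Set.univ) :
    IsPreconnected (e ⁻¹' Kᶜ) := by
  have hS : IsOpen (e ⁻¹' Kᶜ) := hK.isOpen_compl.preimage he.continuous
  have key : ∀ A B : Set X, IsOpen A → IsOpen B → Disjoint A B → A ∪ B = e ⁻¹' Kᶜ →
      p ∈ closure (e '' A) → B = ∅ := by
    intro A B hA hB hAB hu hpA
    have huniv := hirr _ (isClosed_closure.union hK)
      (isPreconnected_closure_image_union he hd hK hKc hA hB hAB hu) (Or.inl hpA) (Or.inr hq)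
    rw [Set.eq_empty_iff_forall_notMem]
    intro x hx
    have hxK : e x ∉ K := by
      have hx' : x ∈ e ⁻¹' Kᶜ := hu ▸ Or.inr hx
      exact hx'
    have hxc : e x ∈ closure (e '' A) ∪ K := huniv ▸ Set.mem_univ _
    have hxA : x ∈ closure A := by
      rw [he.closure_eq_preimage_closure_image]
      exact hxc.resolve_right hxK
    exact (hAB.closure_left hB).le_bot ⟨hxA, hx⟩
  intro u v hu hv hsub hSu hSv
  by_contra hne
  have hdis : Disjoint (e ⁻¹' Kᶜ ∩ u) (e ⁻¹' Kᶜ ∩ v) := by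
    rw [Set.disjoint_left]
    exact fun x hx hx' => hne ⟨x, hx.1, hx.2, hx'.2⟩
  have hun : (e ⁻¹' Kᶜ ∩ u) ∪ (e ⁻¹' Kᶜ ∩ v) = e ⁻¹' Kᶜ := by
    rw [← Set.inter_union_distrib_left, Set.inter_eq_left.2 hsub]
  have hpc : p ∈ closure (e '' (e ⁻¹' Kᶜ)) := by
    rw [Set.image_preimage_eq_inter_range]
    exact hd.open_subset_closure_inter hK.isOpen_compl hp
  rw [← hun, Set.image_union, closure_union] at hpc
  rcases hpc with h | h
  · exact hSv.ne_empty (key _ _ (hS.inter hu) (hS.inter hv) hdis hun h)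
  · exact hSu.ne_empty (key _ _ (hS.inter hv) (hS.inter hu) hdis.symm
      (by rw [Set.union_comm, hun]) h)

/-- If `X` is a connected indecomposable Tychonoff space, then every decomposable
compactification `γ` of `X` (a union of two proper subcontinua) is reducible between
every pair of its points; equivalently, every irreducible compactification of `X` is
indecomposable. -/
theorem decomposable_compactification_reducible
    (X : Type) [TopologicalSpace X] [T35Space X] [ConnectedSpace X]
    (hX : IndecomposableSpace X)
    (γ : Type) [TopologicalSpace γ] [CompactSpace γ] [T2Space γ]
    (e : X → γ) (he : Topology.IsEmbedding e) (hd : DenseRange e)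
    (H K : Set γ) (hH : IsClosed H) (hHc : IsPreconnected H) (hHp : H ≠ Set.univ)
    (hK : IsClosed K) (hKc : IsPreconnected K) (hKp : K ≠ Set.univ)
    (hHK : H ∪ K = Set.univ) :
    ∀ p q : γ, ∃ C : Set γ, IsClosed C ∧ IsPreconnected C ∧ C ≠ Set.univ ∧
      p ∈ C ∧ q ∈ C := by
  have key : ∀ p q : γ, p ∉ K → q ∈ K →
      ∃ C : Set γ, IsClosed C ∧ IsPreconnected C ∧ C ≠ Set.univ ∧ p ∈ C ∧ q ∈ C := by
    intro p q hp hq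
    by_contra! hirr
    have hpre : IsPreconnected (e ⁻¹' Kᶜ) :=
      isPreconnected_preimage_compl_of_irreducible he hd hK hKc hp hq
        fun C hC hCc hpC hqC => by_contra fun hCu => hirr C hC hCc hCu hpC hqC
    have hopen : IsOpen (e ⁻¹' Kᶜ) := hK.isOpen_compl.preimage he.continuous
    have hne : (e ⁻¹' Kᶜ).Nonempty := hd.exists_mem_open hK.isOpen_compl ⟨p, hp⟩
    have hsub : Kᶜ ⊆ H := fun x hx =>
      (hHK.ge (Set.mem_univ x)).resolve_right hx
    rcases hX _ ⟨hne, hpre⟩ with hdense | hnd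
    · obtain ⟨x, hx⟩ := hd.exists_mem_open hH.isOpen_compl (Set.nonempty_compl.2 hHp)
      obtain ⟨y, hyH, hyK⟩ := hdense.inter_open_nonempty _
        (hH.isOpen_compl.preimage he.continuous) ⟨x, hx⟩
      exact hyH (hsub hyK)
    · have hint : e ⁻¹' Kᶜ ⊆ interior (closure (e ⁻¹' Kᶜ)) :=
        interior_maximal subset_closure hopen
      rw [show interior (closure (e ⁻¹' Kᶜ)) = ∅ from hnd] at hint
      exact hne.ne_empty (Set.subset_empty_iff.1 hint)
  intro p q
  by_cases hp : p ∈ K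
  · by_cases hq : q ∈ K
    · exact ⟨K, hK, hKc, hKp, hp, hq⟩
    · obtain ⟨C, hC, hCc, hCu, hqC, hpC⟩ := key q p hq hp
      exact ⟨C, hC, hCc, hCu, hpC, hqC⟩
  · by_cases hq : q ∈ K
    · exact key p q hp hq
    · exact ⟨H, hH, hHc, hHp, (hHK.ge (Set.mem_univ p)).resolve_right hp,
        (hHK.ge (Set.mem_univ q)).resolve_right hq⟩
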